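/- Let G be a finite group and let A, B be subgroups of G. Let c(A) denote the number of subgroups of G conjugate to A, let n_{AB} denote the number of conjugates of B contained in A, and let n_{BA} denote the number of conjugates of A containing B. Then c(A) · n_{AB} = c(B) · n_{BA}. -/

import Mathlib

open MulAction

/-- For an invariant relation `r` between two `G`-sets, every element of the orbit of `x` is
related to the same number of elements of the orbit of `y`. -/
theorem MulAction.card_orbit_mul_card_related {G X Y : Type*} [Group G] [MulAction G X]
    [MulAction G Y] (r : X → Y → Prop) (hr : ∀ (g : G) x y, r x y → r (g • x) (g • y))
    (x : X) (y : Y) :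
    Nat.card (orbit G x) * Nat.card {y' : Y // y' ∈ orbit G y ∧ r x y'} =
      Nat.card {p : X × Y // p.1 ∈ orbit G x ∧ p.2 ∈ orbit G y ∧ r p.1 p.2} := by
  choose g hg using fun x' : orbit G x => x'.2
  simp only at hg
  rw [← Nat.card_prod]
  refine Nat.card_congr
    { toFun := fun p => ⟨(p.1, g p.1 • p.2.1), p.1.2,
        mem_orbit_of_mem_orbit _ p.2.2.1, ?_⟩
      invFun := fun p => (⟨p.1.1, p.2.1⟩, ⟨(g ⟨p.1.1, p.2.1⟩)⁻¹ • p.1.2,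
        mem_orbit_of_mem_orbit _ p.2.2.1, ?_⟩)
      left_inv := fun p => by simp
      right_inv := fun p => by simp }
  · simpa only [hg] using hr (g p.1) _ _ p.2.2.2
  · have h := hr (g ⟨p.1.1, p.2.1⟩)⁻¹ _ _ p.2.2.2
    rwa [inv_smul_eq_iff.2 (hg ⟨p.1.1, p.2.1⟩).symm] at h

/-- Double counting of the related pairs between two orbits. -/
theorem MulAction.card_orbit_mul_card_related_comm {G X Y : Type*} [Group G] [MulAction G X]
    [MulAction G Y] (r : X → Y → Prop) (hr : ∀ (g : G) x y, r x y → r (g • x) (g • y))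
    (x : X) (y : Y) :
    Nat.card (orbit G x) * Nat.card {y' : Y // y' ∈ orbit G y ∧ r x y'} =
      Nat.card (orbit G y) * Nat.card {x' : X // x' ∈ orbit G x ∧ r x' y} := by
  rw [card_orbit_mul_card_related r hr,
    card_orbit_mul_card_related (fun y x => r x y) (fun g y x => hr g x y)]
  exact Nat.card_congr ((Equiv.prodComm X Y).subtypeEquiv fun p => and_left_comm)

/-- For a finite group `G` and subgroups `A, B` of `G`:
`c(A) * n_{AB} = c(B) * n_{BA}`, where `c(A)` is the number of conjugates of `A`,
`n_{AB}` the number of conjugates of `B` contained in `A`, and `n_{BA}` the number of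
conjugates of `A` containing `B`. -/
theorem card_conj_mul_eq (G : Type*) [Group G] [Finite G] (A B : Subgroup G) :
    Nat.card {A' : Subgroup G // ∃ g : G, A.map (MulAut.conj g).toMonoidHom = A'} *
      Nat.card {B' : Subgroup G //
        (∃ g : G, B.map (MulAut.conj g).toMonoidHom = B') ∧ B' ≤ A} =
    Nat.card {B' : Subgroup G // ∃ g : G, B.map (MulAut.conj g).toMonoidHom = B'} *
      Nat.card {A' : Subgroup G //
        (∃ g : G, A.map (MulAut.conj g).toMonoidHom = A') ∧ B ≤ A'} := by
  open scoped Pointwise in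
  exact
    card_orbit_mul_card_related_comm (G := ConjAct G) (fun A' B' : Subgroup G => B' ≤ A')
      (fun _ _ _ h => Subgroup.pointwise_smul_le_pointwise_smul_iff.2 h) A B
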